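/- Let B and H be Hopf algebras over a field k and let τ be an invertible skew pairing on (B,H) with convolution inverse τ⁻¹. Then the bilinear form [τ] on the tensor product Hopf algebra B ⊗ H defined by [τ](b⊗g, c⊗h) = ε(b)τ(c,g)ε(h) is a 2-cocycle on B ⊗ H, with convolution inverse given by [τ]⁻¹(b⊗g, c⊗h) = ε(b)τ⁻¹(c,g)ε(h). -/

import Mathlib

/-!
STATEMENT 3: Let B and H be Hopf algebras over a field k and let τ be an invertible skew
pairing on (B,H) with convolution inverse τ⁻¹. Then the bilinear form [τ] on the tensor
product Hopf algebra B ⊗ H defined by [τ](b⊗g, c⊗h) = ε(b)τ(c,g)ε(h) is a 2-cocycle on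
B ⊗ H, with convolution inverse [τ]⁻¹(b⊗g, c⊗h) = ε(b)τ⁻¹(c,g)ε(h).
-/

open TensorProduct Coalgebra LinearMap

noncomputable section

variable {k : Type} [Field k]

/-- Convolution product of linear maps from a coalgebra `C` to an algebra `M`:
`(f * g)(c) = Σ f(c₁) g(c₂)`. -/
def conv {C M : Type} [AddCommGroup C] [Module k C] [Coalgebra k C]
    [Ring M] [Algebra k M] (f g : C →ₗ[k] M) : C →ₗ[k] M :=
  (LinearMap.mul' k M) ∘ₗ (TensorProduct.map f g) ∘ₗ Coalgebra.comul

/-- A skew pairing on the ordered pair `(A, U)`. -/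
structure IsSkewPairing {A U : Type} [Ring A] [Ring U] [HopfAlgebra k A] [HopfAlgebra k U]
    (τ : A ⊗[k] U →ₗ[k] k) : Prop where
  mul_left : ∀ (b c : A) (u : U),
    τ ((b * c) ⊗ₜ u) = conv (τ ∘ₗ TensorProduct.mk k A U b) (τ ∘ₗ TensorProduct.mk k A U c) u
  mul_right : ∀ (b : A) (u v : U),
    τ (b ⊗ₜ (u * v)) =
      conv (τ ∘ₗ (TensorProduct.mk k A U).flip v) (τ ∘ₗ (TensorProduct.mk k A U).flip u) b
  one_left : ∀ u : U, τ (1 ⊗ₜ u) = Coalgebra.counit u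
  one_right : ∀ a : A, τ (a ⊗ₜ 1) = Coalgebra.counit a

/-- A 2-cocycle on a Hopf algebra (or bialgebra) `A`: a convolution-invertible bilinear form
with `σ(1,1) = 1` satisfying `Σ σ(x₁,y₁) σ(x₂y₂,z) = Σ σ(y₁,z₁) σ(x,y₂z₂)`. -/
def IsCocycle {A : Type} [Ring A] [Algebra k A] [Coalgebra k A]
    (σ : A ⊗[k] A →ₗ[k] k) : Prop :=
  (∃ σi : A ⊗[k] A →ₗ[k] k, conv σ σi = Coalgebra.counit ∧ conv σi σ = Coalgebra.counit) ∧
  σ ((1 : A) ⊗ₜ (1 : A)) = 1 ∧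
  ∀ x y z : A,
    conv σ (σ ∘ₗ ((TensorProduct.mk k A A).flip z) ∘ₗ LinearMap.mul' k A) (x ⊗ₜ y)
      = conv σ (σ ∘ₗ (TensorProduct.mk k A A x) ∘ₗ LinearMap.mul' k A) (y ⊗ₜ z)

variable {B H : Type} [Ring B] [Ring H] [HopfAlgebra k B] [HopfAlgebra k H]

/-- The bilinear form `[τ](b⊗g, c⊗h) = ε(b) τ(c,g) ε(h)` on `B ⊗ H`. -/
def bracket (τ : B ⊗[k] H →ₗ[k] k) : (B ⊗[k] H) ⊗[k] (B ⊗[k] H) →ₗ[k] k :=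
  τ ∘ₗ
    TensorProduct.map
      ((TensorProduct.lid k B).toLinearMap ∘ₗ
        TensorProduct.map (Coalgebra.counit (R := k)) LinearMap.id)
      ((TensorProduct.rid k H).toLinearMap ∘ₗ
        TensorProduct.map LinearMap.id (Coalgebra.counit (R := k)))
    ∘ₗ (TensorProduct.tensorTensorTensorComm k B H B H).toLinearMap

lemma conv_apply_repr {C M ι : Type} [AddCommGroup C] [Module k C] [Coalgebra k C]
    [Ring M] [Algebra k M] (f g : C →ₗ[k] M) {x : C} (r : Coalgebra.Repr k x ι) :
    conv f g x = ∑ i ∈ r.index, f (r.left i) * g (r.right i) := by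
  simp [conv, ← r.eq]

lemma conv_tmul_repr {C D M ι κ : Type} [Ring C] [Bialgebra k C]
    [Ring D] [Bialgebra k D] [Ring M] [Algebra k M]
    (f g : C ⊗[k] D →ₗ[k] M) {x : C} {y : D}
    (r : Coalgebra.Repr k x ι) (s : Coalgebra.Repr k y κ) :
    conv f g (x ⊗ₜ y) = ∑ i ∈ r.index, ∑ j ∈ s.index,
      f (r.left i ⊗ₜ s.left j) * g (r.right i ⊗ₜ s.right j) := by
  rw [conv_apply_repr f g (Coalgebra.Repr.tmul r s)]
  exact Finset.sum_product _ _ _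

lemma sum_counit_right_smul {C ι : Type} [AddCommGroup C] [Module k C] [Coalgebra k C] {x : C}
    (r : Coalgebra.Repr k x ι) :
    ∑ i ∈ r.index, counit (R := k) (r.right i) • r.left i = x := by
  simpa only [map_sum, TensorProduct.rid_tmul, one_smul]
    using congrArg (TensorProduct.rid k C) (sum_tmul_counit_eq (R := k) r)

lemma conv_add_right {C M : Type} [AddCommGroup C] [Module k C] [Coalgebra k C]
    [Ring M] [Algebra k M] (f g g' : C →ₗ[k] M) : conv f (g + g') = conv f g + conv f g' := by
  simp [conv, TensorProduct.map_add_right, LinearMap.comp_add, LinearMap.add_comp]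

lemma conv_zero_right {C M : Type} [AddCommGroup C] [Module k C] [Coalgebra k C]
    [Ring M] [Algebra k M] (f : C →ₗ[k] M) : conv f 0 = 0 := by
  simp [conv]

@[simp]
lemma bracket_tmul (τ : B ⊗[k] H →ₗ[k] k) (b c : B) (g h : H) :
    bracket τ ((b ⊗ₜ g) ⊗ₜ (c ⊗ₜ h)) = counit (R := k) b * τ (c ⊗ₜ g) * counit (R := k) h := by
  simp [bracket, ← TensorProduct.smul_tmul', TensorProduct.tmul_smul]
  ring

lemma conv_bracket_tmul {ι κ : Type} (σ : B ⊗[k] H →ₗ[k] k)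
    (ρ : (B ⊗[k] H) ⊗[k] (B ⊗[k] H) →ₗ[k] k) (b : B) (h : H) {c : B} {g : H}
    (rc : Coalgebra.Repr k c ι) (rg : Coalgebra.Repr k g κ) :
    conv (bracket σ) ρ ((b ⊗ₜ g) ⊗ₜ (c ⊗ₜ h)) = ∑ i ∈ rc.index, ∑ j ∈ rg.index,
      σ (rc.left i ⊗ₜ rg.left j) * ρ ((b ⊗ₜ rg.right j) ⊗ₜ (rc.right i ⊗ₜ h)) := by
  let rb := ℛ k b
  let rh := ℛ k h
  have expand (g' : H) (c' : B) : ρ ((b ⊗ₜ g') ⊗ₜ (c' ⊗ₜ h)) =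
      ∑ m ∈ rb.index, ∑ n ∈ rh.index, counit (R := k) (rb.left m) *
        (counit (R := k) (rh.left n) * ρ ((rb.right m ⊗ₜ g') ⊗ₜ (c' ⊗ₜ rh.right n))) := by
    conv_lhs => rw [← sum_counit_smul rb, ← sum_counit_smul rh]
    simp only [TensorProduct.sum_tmul, TensorProduct.tmul_sum, map_sum,
      ← TensorProduct.smul_tmul', TensorProduct.tmul_smul, map_smul, smul_eq_mul,
      Finset.mul_sum]
    rw [Finset.sum_comm]
    simp only [mul_left_comm]
  have expand_conv := conv_tmul_repr (bracket σ) ρ (rb.tmul rg) (rc.tmul rh)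
  simp only [Coalgebra.Repr.tmul, Finset.sum_product, bracket_tmul] at expand_conv
  rw [expand_conv]
  simp only [expand, Finset.mul_sum]
  rw [Finset.sum_comm' (t' := rg.index) (s' := fun _ => rb.index) (by simp),
    Finset.sum_comm' (s := rc.index) (t' := rg.index) (s' := fun _ => rc.index) (by simp)]
  refine Finset.sum_congr rfl fun j _ => ?_
  rw [Finset.sum_comm]
  refine Finset.sum_congr rfl fun i _ => Finset.sum_congr rfl fun m _ =>
    Finset.sum_congr rfl fun n _ => ?_
  ring

lemma conv_bracket_bracket (σ τ : B ⊗[k] H →ₗ[k] k) :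
    conv (bracket σ) (bracket τ) = bracket (conv σ τ) := by
  ext b g c h
  simp only [TensorProduct.AlgebraTensorModule.curry_apply, TensorProduct.curry_apply,
    LinearMap.coe_restrictScalars]
  rw [conv_bracket_tmul σ _ b h (ℛ k c) (ℛ k g), bracket_tmul,
    conv_tmul_repr σ τ (ℛ k c) (ℛ k g)]
  simp only [bracket_tmul, Finset.mul_sum, Finset.sum_mul]
  refine Finset.sum_congr rfl fun i _ => Finset.sum_congr rfl fun j _ => ?_
  ring

lemma bracket_counit : bracket (counit (R := k) (A := B ⊗[k] H)) = counit := by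
  ext b g c h
  simp only [TensorProduct.AlgebraTensorModule.curry_apply, TensorProduct.curry_apply,
    LinearMap.coe_restrictScalars, bracket_tmul, TensorProduct.counit_tmul, smul_eq_mul]
  ring

lemma IsSkewPairing.bracket_cocycle_tmul {τ : B ⊗[k] H →ₗ[k] k} (hτ : IsSkewPairing τ)
    (b c d : B) (g h e : H) :
    conv (bracket τ) (bracket τ ∘ₗ ((TensorProduct.mk k (B ⊗[k] H) (B ⊗[k] H)).flip (d ⊗ₜ e)) ∘ₗ
        LinearMap.mul' k (B ⊗[k] H)) ((b ⊗ₜ g) ⊗ₜ (c ⊗ₜ h)) =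
      conv (bracket τ) (bracket τ ∘ₗ (TensorProduct.mk k (B ⊗[k] H) (B ⊗[k] H) (b ⊗ₜ g)) ∘ₗ
        LinearMap.mul' k (B ⊗[k] H)) ((c ⊗ₜ h) ⊗ₜ (d ⊗ₜ e)) := by
  let rc := ℛ k c
  let rd := ℛ k d
  let rg := ℛ k g
  let rh := ℛ k h
  have counit_right (u : H) : ∑ i ∈ rc.index, counit (R := k) (rc.right i) * τ (rc.left i ⊗ₜ u) =
      τ (c ⊗ₜ u) := by
    conv_rhs => rw [← sum_counit_right_smul rc]
    simp [TensorProduct.sum_tmul, ← TensorProduct.smul_tmul']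
  have counit_right' (a : B) : ∑ i ∈ rh.index, counit (R := k) (rh.right i) * τ (a ⊗ₜ rh.left i) =
      τ (a ⊗ₜ h) := by
    conv_rhs => rw [← sum_counit_right_smul rh]
    simp [TensorProduct.tmul_sum]
  have lhs : conv (bracket τ) (bracket τ ∘ₗ
        ((TensorProduct.mk k (B ⊗[k] H) (B ⊗[k] H)).flip (d ⊗ₜ e)) ∘ₗ
        LinearMap.mul' k (B ⊗[k] H)) ((b ⊗ₜ g) ⊗ₜ (c ⊗ₜ h)) =
      ∑ j ∈ rg.index, ∑ l ∈ rd.index, counit (R := k) b * counit (R := k) e *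
        (τ (c ⊗ₜ rg.left j) * τ (rd.left l ⊗ₜ h) * τ (rd.right l ⊗ₜ rg.right j)) := by
    rw [conv_bracket_tmul τ _ b h rc rg, Finset.sum_comm]
    refine Finset.sum_congr rfl fun j _ => ?_
    have mul_right := hτ.mul_right d (rg.right j) h
    rw [conv_apply_repr _ _ rd] at mul_right
    simp only [LinearMap.comp_apply, LinearMap.flip_apply, TensorProduct.mk_apply] at mul_right
    simp only [LinearMap.comp_apply, LinearMap.mul'_apply, LinearMap.flip_apply,
      TensorProduct.mk_apply, Algebra.TensorProduct.tmul_mul_tmul, bracket_tmul,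
      Bialgebra.counit_mul, mul_right, ← counit_right (rg.left j), Finset.mul_sum,
      Finset.sum_mul]
    rw [Finset.sum_comm]
    refine Finset.sum_congr rfl fun l _ => Finset.sum_congr rfl fun i _ => ?_
    ring
  have rhs : conv (bracket τ) (bracket τ ∘ₗ
        (TensorProduct.mk k (B ⊗[k] H) (B ⊗[k] H) (b ⊗ₜ g)) ∘ₗ
        LinearMap.mul' k (B ⊗[k] H)) ((c ⊗ₜ h) ⊗ₜ (d ⊗ₜ e)) =
      ∑ l ∈ rd.index, ∑ j ∈ rg.index, counit (R := k) b * counit (R := k) e *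
        (τ (c ⊗ₜ rg.left j) * τ (rd.left l ⊗ₜ h) * τ (rd.right l ⊗ₜ rg.right j)) := by
    rw [conv_bracket_tmul τ _ c e rd rh]
    refine Finset.sum_congr rfl fun l _ => ?_
    have mul_left := hτ.mul_left c (rd.right l) g
    rw [conv_apply_repr _ _ rg] at mul_left
    simp only [LinearMap.comp_apply, TensorProduct.mk_apply] at mul_left
    simp only [LinearMap.comp_apply, LinearMap.mul'_apply,
      TensorProduct.mk_apply, Algebra.TensorProduct.tmul_mul_tmul, bracket_tmul,
      Bialgebra.counit_mul, mul_left, ← counit_right' (rd.left l), Finset.mul_sum,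
      Finset.sum_mul]
    rw [Finset.sum_comm]
    refine Finset.sum_congr rfl fun j _ => Finset.sum_congr rfl fun i _ => ?_
    ring
  rw [lhs, rhs, Finset.sum_comm]

theorem bracket_isCocycle (τ : B ⊗[k] H →ₗ[k] k) (hτ : IsSkewPairing τ)
    (τi : B ⊗[k] H →ₗ[k] k)
    (hinv₁ : conv τ τi = Coalgebra.counit) (hinv₂ : conv τi τ = Coalgebra.counit) :
    IsCocycle (bracket τ) ∧
    conv (bracket τ) (bracket τi) = Coalgebra.counit ∧
    conv (bracket τi) (bracket τ) = Coalgebra.counit := by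
  have right_inv : conv (bracket τ) (bracket τi) = counit := by
    rw [conv_bracket_bracket, hinv₁, bracket_counit]
  have left_inv : conv (bracket τi) (bracket τ) = counit := by
    rw [conv_bracket_bracket, hinv₂, bracket_counit]
  refine ⟨⟨⟨bracket τi, right_inv, left_inv⟩, ?_, fun x y z => ?_⟩, right_inv, left_inv⟩
  · simp [Algebra.TensorProduct.one_def, hτ.one_left]
  · induction z using TensorProduct.induction_on with
    | zero => simp [conv_zero_right]
    | add z z' hz hz' =>
      simp only [map_add, TensorProduct.tmul_add, LinearMap.add_comp, LinearMap.comp_add,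
        conv_add_right, LinearMap.add_apply, hz, hz']
    | tmul d e =>
      induction x using TensorProduct.induction_on with
      | zero => simp [conv_zero_right]
      | add x x' hx hx' =>
        simp only [map_add, TensorProduct.add_tmul, LinearMap.add_comp, LinearMap.comp_add,
          conv_add_right, LinearMap.add_apply, hx, hx']
      | tmul b g =>
        induction y using TensorProduct.induction_on with
        | zero => simp
        | add y y' hy hy' =>
          simp only [map_add, TensorProduct.add_tmul, TensorProduct.tmul_add, hy, hy']
        | tmul c h => exact hτ.bracket_cocycle_tmul b c d g h e

end
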